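/- arXiv:1708.09246 — 2 statements merged into one kernel-verified Lean document; each statement's English description precedes it below -/
import Mathlib

section
/- For the cycle graph C_N on the vertex set {0,1,…,n}, where N = n+1 ≥ 3 and the edges are {0,1}, {1,2}, …, {n−1,n}, {n,0}, the normalized volume of its adjacency polytope equals N·binom(N−1, ⌊(N−1)/2⌋); that is, NVol_n(∇_{C_N}) = N·binom(N−1, ⌊(N−1)/2⌋). -/
open MeasureTheory

/-- The standard "vertex embedding": vertex `0` of the graph maps to the origin of `ℝ^n`,
and vertex `i ≥ 1` maps to the standard basis vector `e_i`. -/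
noncomputable def graphVert (n : ℕ) (i : Fin (n + 1)) : Fin n → ℝ :=
  if h : i = 0 then 0 else Pi.single (i.pred h) 1

/-- The adjacency polytope of the cycle graph `C_N` on vertices `{0,1,…,n}` (with `N = n+1`),
whose edges are `{i, i+1 mod N}`: it is `conv{±(e_i - e_j) : {i,j} ∈ E(C_N)}`. -/
noncomputable def cycleAdjPolytope (n : ℕ) : Set (Fin n → ℝ) :=
  convexHull ℝ {v | ∃ i : Fin (n + 1),
    v = graphVert n (i + 1) - graphVert n i ∨ v = graphVert n i - graphVert n (i + 1)}

namespace CycVol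

/-- The vector `(0, x)` indexed by `Option`. -/
def yv {n : ℕ} (x : Fin n → ℝ) : Option (Fin n) → ℝ := fun o => o.elim 0 x

/-- The polytope after a unimodular change of coordinates. -/
def Q (n : ℕ) : Set (Fin n → ℝ) := {x | ∃ t : ℝ, ∑ i, |yv x i - t| ≤ 1}

/-- generators of `Q` -/
noncomputable def wv (n : ℕ) : Option (Fin n) → Fin n → ℝ :=
  fun o => o.elim (fun _ => 1) (fun k => Pi.single k 1)

lemma mem_Q_iff {n : ℕ} (x : Fin n → ℝ) : x ∈ Q n ↔ ∃ t : ℝ, |t| + ∑ i, |x i - t| ≤ 1 := by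
  simp [Q, yv, Fintype.sum_option]

lemma Q_convex (n : ℕ) : Convex ℝ (Q n) := by
  intro x hx y hy a b ha hb hab
  rw [mem_Q_iff] at *
  obtain ⟨s, hs⟩ := hx
  obtain ⟨t, ht⟩ := hy
  refine ⟨a * s + b * t, ?_⟩
  have h1 : |a * s + b * t| ≤ a * |s| + b * |t| := by
    refine (abs_add_le _ _).trans ?_
    rw [abs_mul, abs_mul, abs_of_nonneg ha, abs_of_nonneg hb]
  have h2 : ∑ i, |(a • x + b • y) i - (a * s + b * t)|
      ≤ a * ∑ i, |x i - s| + b * ∑ i, |y i - t| := by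
    rw [Finset.mul_sum, Finset.mul_sum, ← Finset.sum_add_distrib]
    refine Finset.sum_le_sum fun i _ => ?_
    have : (a • x + b • y) i - (a * s + b * t) = a * (x i - s) + b * (y i - t) := by
      simp; ring
    rw [this]
    refine (abs_add_le _ _).trans ?_
    rw [abs_mul, abs_mul, abs_of_nonneg ha, abs_of_nonneg hb]
  nlinarith

lemma abs_sum_mem {ι E : Type*} [Fintype ι] [AddCommGroup E] [Module ℝ E] {s : Set E}
    (hs : Convex ℝ s) (h0 : (0 : E) ∈ s) (v : ι → E) (hv : ∀ i, v i ∈ s) (hv' : ∀ i, -v i ∈ s)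
    (c : ι → ℝ) (hc : ∑ i, |c i| ≤ 1) : ∑ i, c i • v i ∈ s := by
  have := hs.sum_mem (t := (Finset.univ : Finset (Option ι)))
    (w := fun o => o.elim (1 - ∑ i, |c i|) (fun i => |c i|))
    (z := fun o => o.elim 0 (fun i => if 0 ≤ c i then v i else - v i)) ?_ ?_ ?_
  · rw [Fintype.sum_option] at this
    simp only [Option.elim, smul_zero, zero_add] at this
    convert this using 2 with i
    split_ifs with h
    · rw [abs_of_nonneg h]
    · rw [abs_of_neg (not_le.1 h)]; simp
  · rintro (_ | i) _
    · simpa using hc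
    · simp
  · simp [Fintype.sum_option]
  · rintro (_ | i) _
    · simpa using h0
    · simp only [Option.elim]
      split_ifs
      exacts [hv i, hv' i]

lemma hull_eq_Q (n : ℕ) :
    convexHull ℝ {v | ∃ o, v = wv n o ∨ v = - wv n o} = Q n := by
  apply subset_antisymm
  · apply convexHull_min _ (Q_convex n)
    rintro v ⟨o, ho⟩
    rw [mem_Q_iff]
    rcases o with _ | k
    · rcases ho with rfl | rfl
      · exact ⟨1, by simp [wv]⟩
      · exact ⟨-1, by simp [wv]⟩
    · refine ⟨0, ?_⟩
      have : ∀ i, |v i - 0| = (Pi.single k 1 : Fin n → ℝ) i := by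
        intro i
        rcases ho with rfl | rfl <;> by_cases h : i = k
        · subst h; simp [wv]
        · simp [wv, h]
        · subst h; simp [wv]
        · simp [wv, h]
      rw [abs_zero, Finset.sum_congr rfl fun i _ => this i]
      simp
  · intro x hx
    rw [mem_Q_iff] at hx
    obtain ⟨t, ht⟩ := hx
    have hsub := subset_convexHull ℝ {v | ∃ o, v = wv n o ∨ v = - wv n o}
    have hc := convex_convexHull ℝ {v | ∃ o, v = wv n o ∨ v = - wv n o}
    have e1 : ∀ o, wv n o ∈ convexHull ℝ {v | ∃ o, v = wv n o ∨ v = - wv n o} :=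
      fun o => hsub ⟨o, Or.inl rfl⟩
    have e2 : ∀ o, -wv n o ∈ convexHull ℝ {v | ∃ o, v = wv n o ∨ v = - wv n o} :=
      fun o => hsub ⟨o, Or.inr rfl⟩
    have h0 : (0 : Fin n → ℝ) ∈ convexHull ℝ {v | ∃ o, v = wv n o ∨ v = - wv n o} := by
      have := hc (e1 none) (e2 none) (a := 1/2) (b := 1/2) (by norm_num) (by norm_num)
        (by norm_num)
      simpa using this
    have := abs_sum_mem hc h0 (wv n) e1 e2 (fun o => o.elim t (fun i => x i - t))
      (by simpa [Fintype.sum_option] using ht)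
    convert this using 1
    ext j
    simp [Fintype.sum_option, wv, Finset.sum_apply, Pi.single_apply]

/-- change of coordinates -/
noncomputable def Tm (n : ℕ) : Matrix (Fin n) (Fin n) ℝ :=
  Matrix.of fun j i => graphVert n i.succ j - graphVert n i.castSucc j

lemma gv_apply (n : ℕ) (i : Fin (n + 1)) (j : Fin n) :
    graphVert n i j = if i = j.succ then 1 else 0 := by
  unfold graphVert
  refine Fin.cases ?_ (fun k => ?_) i
  · simp [(Fin.succ_ne_zero j).symm]
  · simp [Pi.single_apply, eq_comm]

lemma det_Tm (n : ℕ) : (Tm n).det = 1 := by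
  rw [Matrix.det_of_isUpperTriangular]
  · apply Finset.prod_eq_one
    intro i _
    have : i.castSucc ≠ i.succ := by simp [Fin.ext_iff]
    simp [Tm, gv_apply, this]
  · intro j i (hij : i < j)
    have h1 : i.succ ≠ j.succ := by simp [hij.ne]
    have h2 : i.castSucc ≠ j.succ := by
      rw [Fin.lt_def] at hij
      simp [Fin.ext_iff]; omega
    simp only [Tm, Matrix.of_apply, gv_apply, if_neg h1, if_neg h2, sub_zero]

lemma Tm_some (n : ℕ) (k : Fin n) :
    Matrix.toLin' (Tm n) (wv n (some k)) = graphVert n k.succ - graphVert n k.castSucc := by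
  ext j
  simp [wv, Tm]

lemma Tm_none (n : ℕ) :
    Matrix.toLin' (Tm n) (wv n none) = graphVert n (Fin.last n) - graphVert n 0 := by
  ext j
  simp only [wv, Option.elim, Matrix.toLin'_apply, Matrix.mulVec, dotProduct, Tm,
    Matrix.of_apply, mul_one, Finset.sum_sub_distrib, Pi.sub_apply]
  have h1 := Fin.sum_univ_succ (fun i => graphVert n i j)
  have h2 := Fin.sum_univ_castSucc (fun i => graphVert n i j)
  linarith

lemma poly_eq (n : ℕ) : cycleAdjPolytope n = Matrix.toLin' (Tm n) '' Q n := by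
  rw [← hull_eq_Q, LinearMap.image_convexHull]
  unfold cycleAdjPolytope
  congr 1
  ext v
  simp only [Set.mem_ofPred_eq, Set.mem_image]
  constructor
  · rintro ⟨i, hi⟩
    induction i using Fin.lastCases with
    | last =>
      rw [Fin.last_add_one] at hi
      rcases hi with rfl | rfl
      · exact ⟨- wv n none, ⟨none, Or.inr rfl⟩, by rw [map_neg, Tm_none]; simp⟩
      · exact ⟨wv n none, ⟨none, Or.inl rfl⟩, by rw [Tm_none]⟩
    | cast k =>
      rw [Fin.coeSucc_eq_succ] at hi
      rcases hi with rfl | rfl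
      · exact ⟨wv n (some k), ⟨some k, Or.inl rfl⟩, by rw [Tm_some]⟩
      · exact ⟨- wv n (some k), ⟨some k, Or.inr rfl⟩, by rw [map_neg, Tm_some]; simp⟩
  · rintro ⟨w, ⟨_ | k, rfl | rfl⟩, rfl⟩
    · exact ⟨Fin.last n, Or.inr (by rw [Fin.last_add_one, Tm_none])⟩
    · exact ⟨Fin.last n, Or.inl (by rw [Fin.last_add_one, map_neg, Tm_none]; simp)⟩
    · exact ⟨k.castSucc, Or.inl (by rw [Fin.coeSucc_eq_succ, Tm_some])⟩
    · exact ⟨k.castSucc, Or.inr (by rw [Fin.coeSucc_eq_succ, map_neg, Tm_some]; simp)⟩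

lemma vol_poly (n : ℕ) : volume (cycleAdjPolytope n) = volume (Q n) := by
  rw [poly_eq, Measure.addHaar_image_linearMap, LinearMap.det_toLin', det_Tm]
  simp

/-- the reflections -/
def psi {n : ℕ} (m : Option (Fin n)) : (Fin n → ℝ) →ₗ[ℝ] (Fin n → ℝ) where
  toFun x := fun j => yv x (Equiv.swap none m (some j)) - yv x m
  map_add' x y := by
    ext j
    have : ∀ o, yv (x + y) o = yv x o + yv y o := by rintro (_ | o) <;> simp [yv]
    simp only [this, Pi.add_apply]; ring
  map_smul' c x := by
    ext j
    have : ∀ o, yv (c • x) o = c * yv x o := by rintro (_ | o) <;> simp [yv]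
    simp only [this, Pi.smul_apply, smul_eq_mul, RingHom.id_apply]; ring

lemma psi_apply {n : ℕ} (m : Option (Fin n)) (x : Fin n → ℝ) (j : Fin n) :
    psi m x j = yv x (Equiv.swap none m (some j)) - yv x m := rfl

lemma yv_psi {n : ℕ} (m o : Option (Fin n)) (x : Fin n → ℝ) :
    yv (psi m x) o = yv x (Equiv.swap none m o) - yv x m := by
  rcases o with _ | j
  · simp [yv]
  · rfl

lemma psi_psi {n : ℕ} (m : Option (Fin n)) : psi m ∘ₗ psi m = LinearMap.id := by
  refine LinearMap.ext fun x => ?_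
  ext j
  simp only [LinearMap.comp_apply, LinearMap.id_apply]
  rw [psi_apply, yv_psi, yv_psi, Equiv.swap_apply_self, Equiv.swap_apply_right]
  simp [yv]

lemma det_psi {n : ℕ} (m : Option (Fin n)) : |LinearMap.det (psi m)| = 1 := by
  have h := congrArg LinearMap.det (psi_psi m)
  rw [LinearMap.det_comp, LinearMap.det_id] at h
  rcases mul_self_eq_one_iff.1 h with h | h <;> simp [h]

lemma vol_psi {n : ℕ} (m : Option (Fin n)) (s : Set (Fin n → ℝ)) :
    volume (psi m ⁻¹' s) = volume s := by
  have h := det_psi m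
  rw [Measure.addHaar_preimage_linearMap]
  · rw [abs_inv, h]; simp
  · intro h0; rw [h0] at h; simp at h

lemma sum_psi {n : ℕ} {M : Type*} [AddCommMonoid M] (F : ℝ → M) (h0 : F 0 = 0)
    (m : Option (Fin n)) (x : Fin n → ℝ) :
    ∑ i, F (yv x i - yv x m) = ∑ j, F (psi m x j) := by
  rw [← Equiv.sum_comp (Equiv.swap none m), Fintype.sum_option]
  simp [h0, psi_apply]

/-- the basic open cell decomposed -/
def A (n : ℕ) : Set (Fin n → ℝ) :=
  {z | (∀ j, z j ≠ 0) ∧ (Finset.univ.filter fun j => z j < 0).card = n / 2 ∧ ∑ j, |z j| ≤ 1}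

open Classical in
/-- rank -/
noncomputable def rk {n : ℕ} (x : Fin n → ℝ) (m : Option (Fin n)) : ℕ :=
  (Finset.univ.filter fun i => yv x i < yv x m).card

lemma rk_psi {n : ℕ} (x : Fin n → ℝ) (m : Option (Fin n)) :
    rk x m = (Finset.univ.filter fun j => psi m x j < 0).card := by
  have := sum_psi (fun t : ℝ => if t < 0 then (1 : ℕ) else 0) (by simp) m x
  simp only [sub_neg] at this
  rw [rk, Finset.card_filter, Finset.card_filter, ← this]

lemma mem_psiA {n : ℕ} (x : Fin n → ℝ) (m : Option (Fin n)) :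
    x ∈ psi m ⁻¹' A n ↔ (∀ i, i ≠ m → yv x i ≠ yv x m) ∧ rk x m = n / 2 ∧
      ∑ i, |yv x i - yv x m| ≤ 1 := by
  rw [sum_psi _ (by simp), rk_psi]
  simp only [A, Set.mem_preimage, Set.mem_ofPred_eq]
  refine and_congr_left fun _ => ?_
  simp only [psi_apply, sub_ne_zero]
  constructor
  · intro h i hi
    have hne : Equiv.swap none m i ≠ none := by
      intro hh
      rw [Equiv.swap_apply_eq_iff] at hh
      simp at hh
      exact hi hh
    obtain ⟨j, hj⟩ := Option.ne_none_iff_exists'.1 hne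
    have := h j
    rwa [← hj, Equiv.swap_apply_self] at this
  · intro h j
    apply h
    intro hh
    rw [Equiv.swap_apply_eq_iff] at hh
    simp at hh

lemma rk_lt {n : ℕ} (x : Fin n → ℝ) {m m' : Option (Fin n)} (h : yv x m < yv x m') :
    rk x m < rk x m' := by
  apply Finset.card_lt_card
  rw [Finset.ssubset_iff_of_subset]
  · exact ⟨m, by simpa using h, by simp⟩
  · intro i hi
    simp only [Finset.mem_filter, Finset.mem_univ, true_and] at hi ⊢
    exact hi.trans h

lemma psiA_disjoint {n : ℕ} :
    Pairwise (Function.onFun Disjoint fun m : Option (Fin n) => psi m ⁻¹' A n) := by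
  intro m m' hm
  rw [Function.onFun, Set.disjoint_left]
  intro x h h'
  rw [mem_psiA] at h h'
  rcases lt_or_gt_of_ne (h'.1 m hm) with hl | hl
  · have := rk_lt x hl; omega
  · have := rk_lt x hl; omega

lemma exists_rk {n : ℕ} (x : Fin n → ℝ) (hx : Function.Injective (yv x)) :
    ∃ m, rk x m = n / 2 := by
  have hb : ∀ m, rk x m < n + 1 := by
    intro m
    have : rk x m < (Finset.univ : Finset (Option (Fin n))).card := by
      apply Finset.card_lt_card
      rw [Finset.ssubset_univ_iff]
      intro h
      have := Finset.mem_univ m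
      rw [← h] at this
      simp at this
    simpa using this
  have hinj : Function.Injective (fun m => (⟨rk x m, hb m⟩ : Fin (n + 1))) := by
    intro m m' h
    simp only [Fin.mk.injEq] at h
    by_contra hne
    rcases lt_or_gt_of_ne (hx.ne hne) with hl | hl
    · have := rk_lt x hl; omega
    · have := rk_lt x hl; omega
  have hbij := (Fintype.bijective_iff_injective_and_card _).2 ⟨hinj, by simp⟩
  obtain ⟨m, hm⟩ := hbij.2 ⟨n / 2, by omega⟩
  exact ⟨m, by simpa using hm⟩

lemma median_le {n : ℕ} (x : Fin n → ℝ) (hx : Function.Injective (yv x)) (m : Option (Fin n))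
    (hm : rk x m = n / 2) (t : ℝ) : ∑ i, |yv x i - yv x m| ≤ ∑ i, |yv x i - t| := by
  classical
  set y := yv x
  have hcard : (Finset.univ.filter fun i => y i < y m).card = n / 2 := by
    rw [← hm, rk]
  set d : ℝ := 2 * ((n / 2 : ℕ) : ℝ) - n with hd
  have hd1 : |d| ≤ 1 := by
    have h1 : 2 * (n / 2) ≤ n := by omega
    have h2 : n ≤ 2 * (n / 2) + 1 := by omega
    have h1' : (2 : ℝ) * ((n / 2 : ℕ) : ℝ) ≤ n := by exact_mod_cast h1
    have h2' : (n : ℝ) ≤ 2 * ((n / 2 : ℕ) : ℝ) + 1 := by exact_mod_cast h2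
    rw [abs_le]; constructor <;> linarith
  let s : Option (Fin n) → ℝ := fun i => 1 - 2 * (if y i < y m then 1 else 0)
    + (d - 1) * (if i = m then 1 else 0)
  have hs : ∑ i, s i = 0 := by
    simp only [s, Finset.sum_add_distrib, Finset.sum_sub_distrib, ← Finset.mul_sum,
      Finset.sum_boole, hcard]
    simp [Finset.filter_eq']
    rw [hd]; ring
  have hs1 : ∀ i, |s i| ≤ 1 := by
    intro i
    by_cases h : i = m
    · subst h; simpa [s] using hd1
    · by_cases h' : y i < y m <;> simp [s, h, h'] <;> norm_num
  have hs2 : ∀ i, |y i - y m| = s i * (y i - y m) := by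
    intro i
    by_cases h : i = m
    · subst h; simp
    · by_cases h' : y i < y m
      · rw [abs_of_neg (by linarith)]; simp [s, h, h']; ring
      · rw [abs_of_nonneg (by linarith)]; simp [s, h, h']
  calc ∑ i, |y i - y m| = ∑ i, s i * (y i - y m) := Finset.sum_congr rfl fun i _ => hs2 i
    _ = ∑ i, s i * (y i - t) + (t - y m) * ∑ i, s i := by
        rw [Finset.mul_sum, ← Finset.sum_add_distrib]
        exact Finset.sum_congr rfl fun i _ => by ring
    _ = ∑ i, s i * (y i - t) := by rw [hs]; ring
    _ ≤ ∑ i, |y i - t| := by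
        refine Finset.sum_le_sum fun i _ => ?_
        refine (le_abs_self _).trans ?_
        rw [abs_mul]
        exact mul_le_of_le_one_left (abs_nonneg _) (hs1 i)

lemma ae_ne {n : ℕ} (j : Fin n) : ∀ᵐ x : Fin n → ℝ, x j ≠ 0 := by
  have := Measure.addHaar_submodule (volume : Measure (Fin n → ℝ))
    (LinearMap.ker (LinearMap.proj (R := ℝ) (φ := fun _ : Fin n => ℝ) j)) (by
      intro h
      have h1 : (Pi.single j 1 : Fin n → ℝ) ∈
        LinearMap.ker (LinearMap.proj (R := ℝ) (φ := fun _ : Fin n => ℝ) j) := by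
          rw [h]; trivial
      simp at h1)
  rw [ae_iff]
  convert this using 2
  ext x; simp

lemma ae_inj (n : ℕ) : ∀ᵐ x : Fin n → ℝ, Function.Injective (yv x) := by
  have h : ∀ᵐ x : Fin n → ℝ, ∀ m : Option (Fin n), ∀ j, psi m x j ≠ 0 := by
    rw [ae_all_iff]
    intro m
    rw [ae_all_iff]
    intro j
    have h1 := ae_ne j
    rw [ae_iff] at h1 ⊢
    rw [← vol_psi m] at h1
    exact h1
  filter_upwards [h] with x hx m m' hmm
  by_contra hne
  have hn : Equiv.swap none m' m ≠ none := by
    intro hh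
    rw [Equiv.swap_apply_eq_iff] at hh
    simp at hh
    exact hne hh
  obtain ⟨j, hj⟩ := Option.ne_none_iff_exists'.1 hn
  apply hx m' j
  rw [psi_apply, ← hj, Equiv.swap_apply_self, hmm, sub_self]

lemma Q_ae (n : ℕ) : Q n =ᵐ[volume] ⋃ m : Option (Fin n), psi m ⁻¹' A n := by
  filter_upwards [ae_inj n] with x hx
  apply propext
  change x ∈ Q n ↔ x ∈ ⋃ m : Option (Fin n), psi m ⁻¹' A n
  rw [Set.mem_iUnion]
  constructor
  · rintro ⟨t, ht⟩
    obtain ⟨m, hm⟩ := exists_rk x hx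
    exact ⟨m, (mem_psiA x m).2 ⟨fun i hi => hx.ne hi, hm, (median_le x hx m hm t).trans ht⟩⟩
  · rintro ⟨m, hm⟩
    exact ⟨_, ((mem_psiA x m).1 hm).2.2⟩

/-- signed orthant pieces -/
def O {n : ℕ} (S : Finset (Fin n)) : Set (Fin n → ℝ) :=
  {z | (∀ j, z j ≠ 0) ∧ (Finset.univ.filter fun j => z j < 0) = S ∧ ∑ j, |z j| ≤ 1}

lemma O_eq {n : ℕ} (S : Finset (Fin n)) :
    O S = {z | (∀ j, z j ≠ 0) ∧ (∀ j, z j < 0 ↔ j ∈ S) ∧ ∑ j, |z j| ≤ 1} := by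
  ext z
  simp [O, Finset.ext_iff]

lemma O_meas {n : ℕ} (S : Finset (Fin n)) : MeasurableSet (O S) := by
  rw [O_eq]
  simp only [Set.ofPred_and, Set.ofPred_forall]
  refine (MeasurableSet.iInter fun j => ?_).inter ((MeasurableSet.iInter fun j => ?_).inter ?_)
  · exact (measurableSet_eq_fun (measurable_pi_apply j) measurable_const).compl
  · by_cases h : j ∈ S
    · simp only [h, iff_true]
      exact measurableSet_lt (measurable_pi_apply j) measurable_const
    · simp only [h, iff_false]
      exact (measurableSet_lt (measurable_pi_apply j) measurable_const).compl
  · exact measurableSet_le (by fun_prop) measurable_const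

lemma O_disj {n : ℕ} : Pairwise (Function.onFun Disjoint (O (n := n))) := by
  intro S S' h
  rw [Function.onFun, Set.disjoint_left]
  intro x hx hx'
  exact h (hx.2.1.symm.trans hx'.2.1)

lemma vol_O {n : ℕ} (S : Finset (Fin n)) : volume (O S) = volume (O (∅ : Finset (Fin n))) := by
  have hmp : MeasurePreserving (fun (a : Fin n → ℝ) i => (if i ∈ S then (fun t : ℝ => -t) else id) (a i))
      volume volume := by
    apply volume_preserving_pi (f := fun i : Fin n => if i ∈ S then (fun t : ℝ => -t) else id)
    intro i
    by_cases h : i ∈ S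
    · simp only [h, if_true]; exact Measure.measurePreserving_neg _
    · simp only [h, if_false]; exact MeasurePreserving.id _
  rw [← hmp.measure_preimage (O_meas ∅).nullMeasurableSet]
  congr 1
  rw [O_eq, O_eq]
  ext z
  simp only [Set.mem_preimage, Set.mem_ofPred_eq, Finset.notMem_empty, iff_false]
  have e1 : ∀ j, |(if j ∈ S then (fun t : ℝ => -t) else id) (z j)| = |z j| := by
    intro j; split_ifs <;> simp
  simp only [e1]
  constructor
  · rintro ⟨h1, h2, h3⟩
    refine ⟨fun j => ?_, fun j => ?_, h3⟩
    · have := h1 j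
      split_ifs <;> simpa
    · have := h2 j
      split_ifs with h
      · simpa using (this.2 h).le
      · simpa using fun hh => h (this.1 hh)
  · rintro ⟨h1, h2, h3⟩
    have h1' : ∀ j, z j ≠ 0 := by
      intro j
      have := h1 j
      split_ifs at this <;> simpa using this
    refine ⟨h1', fun j => ?_, h3⟩
    have := h2 j
    split_ifs at this with h
    · simp only [h, iff_true]
      exact lt_of_le_of_ne (by simpa using this) (h1' j)
    · simpa [h] using this

lemma vol_cross (n : ℕ) (hn : 1 ≤ n) :
    volume {x : Fin n → ℝ | ∑ i, |x i| ≤ 1} = 2 ^ n * volume (O (∅ : Finset (Fin n))) := by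
  have h : {x : Fin n → ℝ | ∑ i, |x i| ≤ 1} =ᵐ[volume] ⋃ S : Finset (Fin n), O S := by
    have h0 : ∀ᵐ x : Fin n → ℝ, ∀ j, x j ≠ 0 := ae_all_iff.2 ae_ne
    filter_upwards [h0] with x hx
    apply propext
    change (∑ i, |x i| ≤ 1) ↔ x ∈ ⋃ S : Finset (Fin n), O S
    rw [Set.mem_iUnion]
    exact ⟨fun h => ⟨_, hx, rfl, h⟩, fun ⟨S, h⟩ => h.2.2⟩
  rw [measure_congr h, measure_iUnion O_disj O_meas, tsum_fintype,
    Finset.sum_congr rfl fun S _ => vol_O S]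
  simp

lemma fact_O (n : ℕ) (hn : 1 ≤ n) :
    (n.factorial : ENNReal) * volume (O (∅ : Finset (Fin n))) = 1 := by
  have : Nonempty (Fin n) := ⟨⟨0, hn⟩⟩
  have h := volume_sum_rpow_le (Fin n) (p := 1) le_rfl 1
  simp only [Real.rpow_one, div_one, Fintype.card_fin, ENNReal.ofReal_one, one_pow, one_mul,
    Real.Gamma_nat_eq_factorial] at h
  rw [vol_cross n hn, show (1 : ℝ) + 1 = ((1 : ℕ) : ℝ) + 1 by simp,
    Real.Gamma_nat_eq_factorial, ENNReal.ofReal_div_of_pos (by positivity)] at h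
  simp only [Nat.factorial_one, Nat.cast_one, mul_one] at h
  rw [ENNReal.ofReal_natCast, ENNReal.ofReal_pow (by norm_num), ENNReal.ofReal_ofNat,
    div_eq_mul_inv] at h
  rw [(ENNReal.mul_right_inj (by simp) (by simp)).1 h]
  exact ENNReal.mul_inv_cancel (by simp [Nat.factorial_ne_zero]) (by simp)

lemma A_eq (n : ℕ) : A n = ⋃ S ∈ Finset.powersetCard (n / 2) (Finset.univ : Finset (Fin n)), O S := by
  ext x
  simp only [A, O, Set.mem_iUnion, Set.mem_ofPred_eq, Finset.mem_powersetCard, Finset.subset_univ,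
    true_and, exists_prop]
  constructor
  · rintro ⟨h1, h2, h3⟩
    exact ⟨_, h2, h1, rfl, h3⟩
  · rintro ⟨S, hS, h1, rfl, h3⟩
    exact ⟨h1, hS, h3⟩

lemma A_meas (n : ℕ) : MeasurableSet (A n) := by
  rw [A_eq]
  exact Finset.measurableSet_biUnion _ fun S _ => O_meas S

lemma vol_A (n : ℕ) : volume (A n) = (n.choose (n / 2) : ENNReal) * volume (O (∅ : Finset (Fin n))) := by
  rw [A_eq, measure_biUnion_finset (fun S _ S' _ h => O_disj h) (fun S _ => O_meas S),
    Finset.sum_congr rfl fun S _ => vol_O S]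
  simp

lemma vol_Q (n : ℕ) : volume (Q n) = ((n + 1 : ℕ) : ENNReal) * volume (A n) := by
  rw [measure_congr (Q_ae n), measure_iUnion psiA_disjoint, tsum_fintype,
    Finset.sum_congr rfl fun m _ => vol_psi m _]
  · simp
  · intro m
    exact (LinearMap.continuous_of_finiteDimensional (psi m)).measurable (A_meas n)

end CycVol

/-- For the cycle graph `C_N` on `N = n+1 ≥ 3` vertices, the normalized volume of its adjacency
polytope equals `N · C(N-1, ⌊(N-1)/2⌋)`. -/
theorem nvol_adjPolytope_cycle (n : ℕ) (hn : 2 ≤ n) :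
    (n.factorial : ENNReal) * volume (cycleAdjPolytope n) =
      ((n + 1) * Nat.choose n (n / 2) : ℕ) := by
  have h := CycVol.fact_O n (by omega)
  rw [CycVol.vol_poly, CycVol.vol_Q, CycVol.vol_A, Nat.cast_mul]
  calc _ = ((n + 1 : ℕ) : ENNReal) * (n.choose (n / 2) : ENNReal)
        * ((n.factorial : ENNReal) * volume (CycVol.O (∅ : Finset (Fin n)))) := by ring
    _ = _ := by rw [h, mul_one]
end

section
/- Let n ≥ 3 be odd and let F_0 = conv{e_1, …, e_{(n−1)/2}, −e_{(n+1)/2}, …, −e_n, −(e_1 + ⋯ + e_n)} ⊂ ℝ^n. Then the pyramid over F_0 with apex at the origin satisfies NVol_n(conv({0} ∪ F_0)) = (n+1)/2. -/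
open MeasureTheory

/-- The vertex set of the facet
`F_0 = conv{e_1, …, e_{(n-1)/2}, -e_{(n+1)/2}, …, -e_n, -(e_1 + ⋯ + e_n)} ⊂ ℝ^n`:
in 0-indexed coordinates, `e_i` for `i < (n-1)/2`, `-e_i` for `(n-1)/2 ≤ i`, and the
all-`(-1)`s vector `-(e_1 + ⋯ + e_n)`. -/
def F0vertices (n : ℕ) : Set (Fin n → ℝ) :=
  {v | ∃ i : Fin n,
      ((i : ℕ) < (n - 1) / 2 ∧ v = Pi.single i 1) ∨
      ((n - 1) / 2 ≤ (i : ℕ) ∧ v = -Pi.single i 1)} ∪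
    {(fun _ => -1 : Fin n → ℝ)}


def simp0 (n : ℕ) (r : ℝ) : Set (Fin n → ℝ) := {z | (∀ i, 0 ≤ z i) ∧ ∑ i, z i ≤ r}

lemma simp0_closed (n : ℕ) (r : ℝ) : IsClosed (simp0 n r) := by
  have : simp0 n r = (⋂ i, {z | 0 ≤ z i}) ∩ {z | ∑ i, z i ≤ r} := by
    ext z; simp [simp0]
  rw [this]
  refine IsClosed.inter (isClosed_iInter fun i => isClosed_le (by fun_prop) (by fun_prop)) 
    (isClosed_le (by fun_prop) (by fun_prop))

lemma simp0_vol (n : ℕ) : ∀ r : ℝ, 0 ≤ r →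
    volume (simp0 n r) = ENNReal.ofReal (r ^ n / n.factorial) := by
  induction n with
  | zero =>
    intro r hr
    have : simp0 0 r = Set.univ := by
      ext z; simp [simp0, hr]
    rw [this]; simp [volume_pi]
  | succ n ih =>
    intro r hr
    have mp := (volume_preserving_piFinSuccAbove (fun _ : Fin (n+1) => ℝ) 0).symm
    rw [← mp.measure_preimage_equiv, Measure.volume_eq_prod, Measure.prod_apply
      ((MeasurableEquiv.measurable _) (simp0_closed _ _).measurableSet)]
    have : ∀ t : ℝ, volume (Prod.mk t ⁻¹' ((MeasurableEquiv.piFinSuccAbove (fun _ : Fin (n+1) => ℝ) 0).symm ⁻¹' simp0 (n+1) r))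
        = (Set.Icc 0 r).indicator (fun t => ENNReal.ofReal ((r-t)^n / n.factorial)) t := by
      intro t
      by_cases ht : t ∈ Set.Icc 0 r
      · rw [Set.indicator_of_mem ht, ← ih _ (by linarith [ht.2])]
        congr 1
        ext z
        simp [simp0, MeasurableEquiv.piFinSuccAbove, Fin.forall_fin_succ, Fin.sum_univ_succ, ht.1, le_sub_iff_add_le']
      · rw [Set.indicator_of_notMem ht]
        convert measure_empty (μ := volume)
        ext z
        simp only [simp0, MeasurableEquiv.piFinSuccAbove, Set.mem_preimage, Set.mem_ofPred_eq, Set.mem_empty_iff_false, iff_false]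
        simp [Fin.forall_fin_succ, Fin.sum_univ_succ]
        intro h0 h1
        have := Finset.sum_nonneg (fun i (_ : i ∈ Finset.univ) => h1 i)
        by_contra hc
        exact ht ⟨h0, by linarith⟩
    simp_rw [this]
    rw [lintegral_indicator measurableSet_Icc, ← ofReal_integral_eq_lintegral_ofReal]
    · congr 1
      rw [integral_Icc_eq_integral_Ioc, ← intervalIntegral.integral_of_le hr]
      rw [intervalIntegral.integral_comp_sub_left (fun t => t ^ n / (n.factorial:ℝ)) r]
      simp [intervalIntegral.integral_div, Nat.factorial_succ]
      field_simp
    · exact (Continuous.continuousOn (by fun_prop)).integrableOn_Icc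
    · filter_upwards [ae_restrict_mem measurableSet_Icc] with t ht
      have : 0 ≤ r - t := by linarith [ht.2]
      positivity

def sg (m : ℕ) (i : Fin (2*m+1)) : ℝ := if (i:ℕ) < m then 1 else -1

lemma sg_sum (m : ℕ) : ∑ i, sg m i = -1 := by
  unfold sg
  rw [Fin.sum_univ_eq_sum_range (fun i => if i < m then (1:ℝ) else -1), show 2*m+1 = m + (m+1) by ring,
    Finset.sum_range_add, Finset.sum_congr rfl (g := fun _ => (1:ℝ))]
  · simp
  · intro i hi; simp at hi; simp [hi]

lemma sg_sq (m : ℕ) (i) : sg m i * sg m i = 1 := by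
  unfold sg; split_ifs <;> simp

def LM (m : ℕ) (b : Fin (2*m+1)) : Matrix (Fin (2*m+1)) (Fin (2*m+1)) ℝ :=
  Matrix.diagonal (sg m) * (1 + Matrix.vecMulVec (fun i => if i = b then 0 else -1) (Pi.single b 1))

lemma LM_det (m : ℕ) (b : Fin (2*m+1)) : |(LM m b).det| = 1 := by
  rw [LM, Matrix.det_mul, Matrix.det_diagonal, Matrix.vecMulVec_eq Unit, Matrix.det_one_add_replicateCol_mul_replicateRow]
  simp [Finset.abs_prod]
  apply Finset.prod_eq_one
  intro i _
  unfold sg; split_ifs <;> simp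

lemma LM_apply (m b x i) : (LM m b).toLin' x i = sg m i * (x i - if i = b then 0 else x b) := by
  simp [LM, ← Matrix.mulVec_mulVec, Matrix.mulVec_diagonal, Matrix.add_mulVec, Matrix.vecMulVec_mulVec]
  split_ifs <;> simp [sub_eq_add_neg]

def Qb (m : ℕ) (b : Fin (2*m+1)) : Set (Fin (2*m+1) → ℝ) := (LM m b).toLin' ⁻¹' simp0 _ 1

lemma Qb_vol (m : ℕ) (b : Fin (2*m+1)) : volume (Qb m b) = ENNReal.ofReal (1 / (2*m+1).factorial) := by
  have h := LM_det m b
  rw [Qb, Measure.addHaar_preimage_linearMap, simp0_vol _ _ zero_le_one]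
  · simp [LinearMap.det_toLin', abs_inv, h]
  · rw [LinearMap.det_toLin']; intro h0; simp [h0] at h

lemma Qb_closed (m : ℕ) (b : Fin (2*m+1)) : IsClosed (Qb m b) :=
  (simp0_closed _ _).preimage (LinearMap.continuous_of_finiteDimensional _)

lemma sum_LM (m : ℕ) (b : Fin (2*m+1)) (x : Fin (2*m+1) → ℝ) (hb : m ≤ (b:ℕ)) : ∑ i, (LM m b).toLin' x i = ∑ i, sg m i * x i := by
  simp_rw [LM_apply, mul_sub, Finset.sum_sub_distrib]
  have h : ∀ i, sg m i * (if i = b then 0 else x b) = sg m i * x b - if i = b then sg m b * x b else 0 := by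
    intro i; split_ifs with h <;> simp [h]
  simp_rw [h, Finset.sum_sub_distrib, ← Finset.sum_mul, sg_sum]
  simp [sg, hb.not_gt]

lemma Qb_mem (m : ℕ) (b : Fin (2*m+1)) (x : Fin (2*m+1) → ℝ) (hb : m ≤ (b:ℕ)) : x ∈ Qb m b ↔ 
    (∀ i, 0 ≤ sg m i * (x i - if i = b then 0 else x b)) ∧ ∑ i, sg m i * x i ≤ 1 := by
  have e : x ∈ Qb m b ↔ (∀ i, 0 ≤ (LM m b).toLin' x i) ∧ ∑ i, (LM m b).toLin' x i ≤ 1 := Iff.rfl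
  rw [e, sum_LM m b x hb]
  simp only [LM_apply]

lemma Qb_disj (m : ℕ) (b c : Fin (2*m+1)) (hb : m ≤ (b:ℕ)) (hc : m ≤ (c:ℕ)) (h : b ≠ c) : AEDisjoint volume (Qb m b) (Qb m c) := by
  let f : (Fin (2*m+1) → ℝ) →ₗ[ℝ] ℝ := LinearMap.proj (R := ℝ) (φ := fun _ => ℝ) b - LinearMap.proj (R := ℝ) (φ := fun _ => ℝ) c
  have h0 : volume (LinearMap.ker f : Set (Fin (2*m+1) → ℝ)) = 0 := by
    apply Measure.addHaar_submodule
    intro ht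
    have : Pi.single b 1 ∈ LinearMap.ker f := by rw [ht]; trivial
    simp [f, h.symm] at this
  refine measure_mono_null ?_ h0
  rintro x ⟨h1, h2⟩
  rw [Qb_mem _ _ _ hb] at h1
  rw [Qb_mem _ _ _ hc] at h2
  have h1 := h1.1 c
  have h2 := h2.1 b
  simp [sg, hb.not_gt, hc.not_gt, h, h.symm] at h1 h2
  simp [f]; linarith

def Q (m : ℕ) : Set (Fin (2*m+1) → ℝ) := {x | ∑ i, sg m i * x i ≤ 1 ∧
  ∀ b : Fin (2*m+1), m ≤ (b:ℕ) → x b ≤ 0 ∧ ∀ a : Fin (2*m+1), (a:ℕ) < m → x b ≤ x a}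

lemma Q_conv (m : ℕ) : Convex ℝ (Q m) := by
  rintro x ⟨h1, h2⟩ y ⟨h3, h4⟩ s t hs ht hst
  refine ⟨?_, fun b hb => ⟨?_, fun a ha => ?_⟩⟩
  · have : ∑ i, sg m i * (s • x + t • y) i = s * ∑ i, sg m i * x i + t * ∑ i, sg m i * y i := by
      rw [Finset.mul_sum, Finset.mul_sum, ← Finset.sum_add_distrib]
      refine Finset.sum_congr rfl fun i _ => ?_
      simp; ring
    rw [this]; nlinarith
  · have := (h2 b hb).1
    have := (h4 b hb).1
    simp; nlinarith
  · have := (h2 b hb).2 a ha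
    have := (h4 b hb).2 a ha
    simp; gcongr

lemma K_sub_Q (m : ℕ) : convexHull ℝ ({0} ∪ convexHull ℝ (F0vertices (2*m+1))) ⊆ Q m := by
  apply convexHull_min _ (Q_conv m)
  apply Set.union_subset
  · rintro _ rfl
    simp [Q]
  apply convexHull_min _ (Q_conv m)
  rintro v (⟨i, ⟨h, rfl⟩ | ⟨h, rfl⟩⟩ | rfl)
  · have h : (i:ℕ) < m := by simpa using h
    refine ⟨by simp [sg, h, Pi.single_apply], fun b hb => ⟨?_, fun a ha => ?_⟩⟩
    · have : b ≠ i := by rintro rfl; omega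
      simp [this]
    · have : b ≠ i := by rintro rfl; omega
      simp [this, Pi.single_apply]; split_ifs <;> simp
  · have h : m ≤ (i:ℕ) := by simpa using h
    refine ⟨by simp [sg, h.not_gt, Pi.single_apply], fun b hb => ⟨?_, fun a ha => ?_⟩⟩
    · simp [Pi.single_apply]; split_ifs <;> simp
    · have : a ≠ i := by rintro rfl; omega
      simp [this, Pi.single_apply]; split_ifs <;> simp
  · refine ⟨?_, fun b hb => ⟨by simp, fun a ha => by simp⟩⟩
    rw [← Finset.sum_mul, sg_sum]; simp

lemma Q_sub (m : ℕ) : Q m ⊆ ⋃ b ∈ Finset.univ.filter (fun b : Fin (2*m+1) => m ≤ (b:ℕ)), Qb m b := by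
  rintro x ⟨h1, h2⟩
  obtain ⟨b, hb, hmax⟩ := Finset.exists_max_image (Finset.univ.filter (fun b : Fin (2*m+1) => m ≤ (b:ℕ))) x
    ⟨Fin.last _, by simp; omega⟩
  have hb' : m ≤ (b:ℕ) := by simpa using hb
  refine Set.mem_biUnion hb ((Qb_mem _ _ _ hb').2 ⟨fun i => ?_, h1⟩)
  by_cases hi : i = b
  · subst hi; simp [sg, hb'.not_gt, (h2 i hb').1]
  by_cases hm : (i:ℕ) < m
  · simp [sg, hi, hm, (h2 b hb').2 i hm]
  · simp [sg, hi, hm, hmax i (by simpa using hm)]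

lemma Qb_sub (m : ℕ) (b : Fin (2*m+1)) (hb : m ≤ (b:ℕ)) : Qb m b ⊆ convexHull ℝ ({0} ∪ convexHull ℝ (F0vertices (2*m+1))) := by
  intro x hx
  rw [Qb_mem _ _ _ hb] at hx
  obtain ⟨h1, h2⟩ := hx
  rw [← sum_LM m b x hb] at h2
  simp_rw [← LM_apply] at h1
  set z := (LM m b).toLin' x with hz
  let v : Fin (2*m+1) → Fin (2*m+1) → ℝ := fun i => if i = b then fun _ => -1 else sg m i • Pi.single i 1
  have hv : ∀ i, v i ∈ convexHull ℝ ({0} ∪ convexHull ℝ (F0vertices (2*m+1))) := by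
    intro i
    apply subset_convexHull
    right
    apply subset_convexHull
    by_cases hi : i = b
    · right; simp [v, hi]
    · left
      refine ⟨i, ?_⟩
      by_cases hm : (i:ℕ) < m
      · left; simp [v, hi, sg, hm]
      · right; simp [v, hi, sg, hm]; omega
  have hx : x = ∑ i, z i • v i := by
    ext j
    have h : ∀ i, z i * v i j = (if i = b then x b else 0) + (if i = j then (if i = b then 0 else x i - x b) else 0) := by
      intro i
      rw [hz, LM_apply]
      by_cases hi : i = b
      · simp [v, hi, sg, hb.not_gt]
      · have := sg_sq m i
        by_cases hj : i = j
        · subst hj; simp [v, hi]; linear_combination (x i - x b) * this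
        · simp [v, hi, hj, Ne.symm hj]
    simp only [Finset.sum_apply, Pi.smul_apply, smul_eq_mul, h, Finset.sum_add_distrib]
    simp
    split_ifs with h
    · simp [h]
    · ring
  have key := (convex_convexHull ℝ ({0} ∪ convexHull ℝ (F0vertices (2*m+1)))).sum_mem (t := Finset.univ)
    (w := fun o : Option (Fin (2*m+1)) => o.elim (1 - ∑ i, z i) z)
    (z := fun o => o.elim 0 v) ?_ ?_ ?_
  · rw [Fintype.sum_option] at key
    simp only [Option.elim, smul_zero, zero_add] at key
    rwa [hx]
  · rintro (_|i) _
    · simpa using h2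
    · exact h1 i
  · rw [Fintype.sum_option]; simp
  · rintro (_|i) _
    · apply subset_convexHull; left; rfl
    · exact hv i

/-- For odd `n ≥ 3`, the pyramid over
`F_0 = conv{e_1, …, e_{(n-1)/2}, -e_{(n+1)/2}, …, -e_n, -(e_1 + ⋯ + e_n)}`
with apex at the origin has normalized volume `(n+1)/2`. -/
theorem nvol_pyramid_F0 (n : ℕ) (hn : 3 ≤ n) (hodd : Odd n) :
    (n.factorial : ENNReal) *
        volume (convexHull ℝ ({0} ∪ convexHull ℝ (F0vertices n))) =
      ((n + 1) / 2 : ℕ) := by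
  obtain ⟨m, rfl⟩ := hodd
  have hK : convexHull ℝ ({0} ∪ convexHull ℝ (F0vertices (2*m+1))) = 
      ⋃ b ∈ Finset.univ.filter (fun b : Fin (2*m+1) => m ≤ (b:ℕ)), Qb m b := by
    apply ((K_sub_Q m).trans (Q_sub m)).antisymm
    refine Set.iUnion₂_subset fun b hb => Qb_sub m b (by simpa using hb)
  have hcard : (Finset.univ.filter (fun b : Fin (2*m+1) => m ≤ (b:ℕ))).card = m + 1 := by
    have : Finset.univ.filter (fun b : Fin (2*m+1) => m ≤ (b:ℕ)) = Finset.Ici ⟨m, by omega⟩ := by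
      ext b; simp [Fin.le_def]
    rw [this, Fin.card_Ici]; simp; omega
  rw [hK, measure_biUnion_finset₀]
  · simp_rw [Qb_vol]
    rw [Finset.sum_const, hcard, show (2*m+1+1)/2 = m+1 by omega, one_div, ENNReal.ofReal_inv_of_pos (by positivity),
      ENNReal.ofReal_natCast, nsmul_eq_mul, mul_left_comm, ENNReal.mul_inv_cancel, mul_one]
    · exact_mod_cast Nat.factorial_ne_zero _
    · exact ENNReal.natCast_ne_top _
  · intro b hb c hc hbc
    exact Qb_disj m b c (by simpa using hb) (by simpa using hc) hbc
  · intro b _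
    exact (Qb_closed m b).measurableSet.nullMeasurableSet
end
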